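/- arXiv:2303.10648 — 3 statements merged into one kernel-verified Lean document; each statement's English description precedes it below -/
import Mathlib

section
/- Suppose the affine decomposition holds: A_v(x,u,x',u') = A₀ + Σ_{i=1}^{n_p} A_i ψ_i(x,u,x',u') and B_v(x,u,x',u') = B₀ + Σ_{i=1}^{n_p} B_i ψ_i(x,u,x',u') for all arguments. Then every trajectory (x,u) of x_{k+1} = f(x_k,u_k) satisfies the linear parameter-varying representation Δx_{k+1} = Ā(p_k) Δx_k + B̄(p_k) Δu_k for all k ∈ ℤ, where p_k = ψ(x_k,u_k,x_{k−1},u_{k−1}); i.e., the velocity behavior of the nonlinear system is contained in the behavior of the LPV representation with scheduling signal taking values in the image of ψ. -/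
open Matrix MeasureTheory

/-- Partial Jacobian of `f : ℝ^n × ℝ^m → ℝ^n` with respect to its first argument. -/
noncomputable def Jx {n m : ℕ} (f : (Fin n → ℝ) × (Fin m → ℝ) → Fin n → ℝ)
    (x : Fin n → ℝ) (u : Fin m → ℝ) : Matrix (Fin n) (Fin n) ℝ :=
  Matrix.of fun i j => fderiv ℝ f (x, u) (Pi.single j 1, 0) i

/-- Partial Jacobian of `f : ℝ^n × ℝ^m → ℝ^n` with respect to its second argument. -/
noncomputable def Ju {n m : ℕ} (f : (Fin n → ℝ) × (Fin m → ℝ) → Fin n → ℝ)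
    (x : Fin n → ℝ) (u : Fin m → ℝ) : Matrix (Fin n) (Fin m) ℝ :=
  Matrix.of fun i j => fderiv ℝ f (x, u) (0, Pi.single j 1) i

/-- Velocity matrix `A_v(x,u,x',u') = ∫₀¹ ∂f/∂x (x' + λ(x−x'), u' + λ(u−u')) dλ`
(entrywise integral). -/
noncomputable def Av {n m : ℕ} (f : (Fin n → ℝ) × (Fin m → ℝ) → Fin n → ℝ)
    (x : Fin n → ℝ) (u : Fin m → ℝ) (x' : Fin n → ℝ) (u' : Fin m → ℝ) :
    Matrix (Fin n) (Fin n) ℝ :=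
  Matrix.of fun i j => ∫ l in (0:ℝ)..1, Jx f (x' + l • (x - x')) (u' + l • (u - u')) i j

/-- Velocity matrix `B_v(x,u,x',u') = ∫₀¹ ∂f/∂u (x' + λ(x−x'), u' + λ(u−u')) dλ`
(entrywise integral). -/
noncomputable def Bv {n m : ℕ} (f : (Fin n → ℝ) × (Fin m → ℝ) → Fin n → ℝ)
    (x : Fin n → ℝ) (u : Fin m → ℝ) (x' : Fin n → ℝ) (u' : Fin m → ℝ) :
    Matrix (Fin n) (Fin m) ℝ :=
  Matrix.of fun i j => ∫ l in (0:ℝ)..1, Ju f (x' + l • (x - x')) (u' + l • (u - u')) i j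

/-- Affine scheduling-dependent matrix `Ā(p) = A₀ + Σᵢ pᵢ Aᵢ`. -/
def Abar {nx np : ℕ} (A0 : Matrix (Fin nx) (Fin nx) ℝ)
    (A : Fin np → Matrix (Fin nx) (Fin nx) ℝ) (p : Fin np → ℝ) :
    Matrix (Fin nx) (Fin nx) ℝ :=
  A0 + ∑ i, p i • A i

/-- Affine scheduling-dependent matrix `B̄(p) = B₀ + Σᵢ pᵢ Bᵢ`. -/
def Bbar {nx nu np : ℕ} (B0 : Matrix (Fin nx) (Fin nu) ℝ)
    (B : Fin np → Matrix (Fin nx) (Fin nu) ℝ) (p : Fin np → ℝ) :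
    Matrix (Fin nx) (Fin nu) ℝ :=
  B0 + ∑ i, p i • B i

/-- Mean value identity in integral form: the increment of a `C¹` map equals the sum of the velocity
matrices applied to the increments of its two arguments. -/
theorem sub_eq_Av_mulVec_add_Bv_mulVec {n m : ℕ} (f : (Fin n → ℝ) × (Fin m → ℝ) → Fin n → ℝ)
    (hf : ContDiff ℝ 1 f) (x : Fin n → ℝ) (u : Fin m → ℝ) (x' : Fin n → ℝ) (u' : Fin m → ℝ) :
    f (x, u) - f (x', u') =
      (Av f x u x' u').mulVec (x - x') + (Bv f x u x' u').mulVec (u - u') := by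
  set γ : ℝ → (Fin n → ℝ) × (Fin m → ℝ) :=
    fun l => (x' + l • (x - x'), u' + l • (u - u')) with hγ
  have hγc : Continuous γ := by fun_prop
  have hD : Continuous fun l => fderiv ℝ f (γ l) :=
    (hf.continuous_fderiv one_ne_zero).comp hγc
  have hDi (v : (Fin n → ℝ) × (Fin m → ℝ)) (i : Fin n) :
      Continuous fun l => fderiv ℝ f (γ l) v i :=
    (continuous_apply i).comp (hD.clm_apply continuous_const)
  have hγd (l : ℝ) : HasDerivAt γ (x - x', u - u') l := by
    have h1 : HasDerivAt (fun l : ℝ => x' + l • (x - x')) (x - x') l := by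
      simpa using ((hasDerivAt_id l).smul_const (x - x')).const_add x'
    have h2 : HasDerivAt (fun l : ℝ => u' + l • (u - u')) (u - u') l := by
      simpa using ((hasDerivAt_id l).smul_const (u - u')).const_add u'
    exact h1.prodMk h2
  have hfd (l : ℝ) : HasDerivAt (fun l => f (γ l)) (fderiv ℝ f (γ l) (x - x', u - u')) l :=
    ((hf.differentiable one_ne_zero (γ l)).hasFDerivAt).comp_hasDerivAt l (hγd l)
  ext i
  have hint := intervalIntegral.integral_eq_sub_of_hasDerivAt (a := 0) (b := 1)
    (fun l _ => hasDerivAt_pi.1 (hfd l) i)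
    ((hDi (x - x', u - u') i).intervalIntegrable 0 1)
  have hv : (x - x', u - u') =
      ∑ j, (x - x') j • ((Pi.single j 1, 0) : (Fin n → ℝ) × (Fin m → ℝ)) +
        ∑ j, (u - u') j • ((0, Pi.single j 1) : (Fin n → ℝ) × (Fin m → ℝ)) := by
    ext j <;> simp [Prod.fst_sum, Prod.snd_sum, Finset.sum_apply, Pi.single_apply]
  have hexp (l : ℝ) : fderiv ℝ f (γ l) (x - x', u - u') i =
      ∑ j, fderiv ℝ f (γ l) (Pi.single j 1, 0) i * (x - x') j +
        ∑ j, fderiv ℝ f (γ l) (0, Pi.single j 1) i * (u - u') j := by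
    rw [hv]
    simp only [map_add, map_sum, map_smul, Pi.add_apply, Finset.sum_apply, Pi.smul_apply,
      smul_eq_mul, mul_comm]
  have hA (j : Fin n) :
      Continuous fun l => fderiv ℝ f (γ l) (Pi.single j 1, 0) i * (x - x') j :=
    (hDi _ i).mul continuous_const
  have hB (j : Fin m) :
      Continuous fun l => fderiv ℝ f (γ l) (0, Pi.single j 1) i * (u - u') j :=
    (hDi _ i).mul continuous_const
  have h0 : γ 0 = (x', u') := by simp [hγ]
  have h1 : γ 1 = (x, u) := by simp [hγ]
  rw [h0, h1] at hint
  rw [Pi.sub_apply, ← hint]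
  simp_rw [hexp]
  rw [intervalIntegral.integral_add
      ((continuous_finsetSum _ fun j _ => hA j).intervalIntegrable 0 1)
      ((continuous_finsetSum _ fun j _ => hB j).intervalIntegrable 0 1),
    intervalIntegral.integral_finsetSum fun j _ => (hA j).intervalIntegrable 0 1,
    intervalIntegral.integral_finsetSum fun j _ => (hB j).intervalIntegrable 0 1]
  simp only [intervalIntegral.integral_mul_const]
  rfl

/-- Under the affine decomposition of the velocity matrices over the
basis functions `ψ`, every trajectory of `x_{k+1} = f(x_k,u_k)` satisfies the LPV
representation `Δx_{k+1} = Ā(p_k) Δx_k + B̄(p_k) Δu_k` with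
`p_k = ψ(x_k,u_k,x_{k−1},u_{k−1})`. -/
theorem stmt_2 {nx nu np : ℕ} (f : (Fin nx → ℝ) × (Fin nu → ℝ) → Fin nx → ℝ)
    (hf : ContDiff ℝ 1 f)
    (ψ : (Fin nx → ℝ) → (Fin nu → ℝ) → (Fin nx → ℝ) → (Fin nu → ℝ) → Fin np → ℝ)
    (A0 : Matrix (Fin nx) (Fin nx) ℝ) (A : Fin np → Matrix (Fin nx) (Fin nx) ℝ)
    (B0 : Matrix (Fin nx) (Fin nu) ℝ) (B : Fin np → Matrix (Fin nx) (Fin nu) ℝ)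
    (hA : ∀ x u x' u', Av f x u x' u' = Abar A0 A (ψ x u x' u'))
    (hB : ∀ x u x' u', Bv f x u x' u' = Bbar B0 B (ψ x u x' u'))
    (x : ℤ → Fin nx → ℝ) (u : ℤ → Fin nu → ℝ)
    (hdyn : ∀ k : ℤ, x (k + 1) = f (x k, u k)) :
    ∀ k : ℤ, x (k + 1) - x k =
      (Abar A0 A (ψ (x k) (u k) (x (k - 1)) (u (k - 1)))).mulVec (x k - x (k - 1)) +
      (Bbar B0 B (ψ (x k) (u k) (x (k - 1)) (u (k - 1)))).mulVec (u k - u (k - 1)) := by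
  intro k
  have hk := hdyn (k - 1)
  rw [sub_add_cancel] at hk
  rw [← hA, ← hB, ← sub_eq_Av_mulVec_add_Bv_mulVec f hf, ← hdyn, ← hk]
end

section
/- (Data-based closed-loop velocity representation.) Let data sequences {Δx^d_k, p^d_k, Δu^d_k}_{k=2}^{N+1} satisfy the affine LPV velocity dynamics Δx^d_{k+1} = Ā(p^d_k) Δx^d_k + B̄(p^d_k) Δu^d_k for k = 2,…,N. Form the data matrices U_Δ = [Δu^d_2 ⋯ Δu^d_N], U^p_Δ = [p^d_2⊗Δu^d_2 ⋯ p^d_N⊗Δu^d_N], X_Δ = [Δx^d_2 ⋯ Δx^d_N], X^p_Δ = [p^d_2⊗Δx^d_2 ⋯ p^d_N⊗Δx^d_N], X→_Δ = [Δx^d_3 ⋯ Δx^d_{N+1}], and 𝒢_Δ = col(X_Δ, X^p_Δ, U_Δ, U^p_Δ). Then: (i) if 𝒢_Δ has full row rank (1+n_p)(n_x+n_u), for any controller matrices K₀, K̄ = [K₁ ⋯ K_{n_p}] there exists 𝒱 ∈ ℝ^{(N−1) × n_x(1+n_p+n_p²)} satisfying 𝒢_Δ 𝒱 = [[I_{n_x},0,0],[0,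 I_{n_p}⊗I_{n_x}, 0],[K₀, K̄, 0],[0, I_{n_p}⊗K₀, I_{n_p}⊗K̄]]; and (ii) for any 𝒱 satisfying this equation and all p ∈ ℝ^{n_p}, v ∈ ℝ^{n_x}, one has X→_Δ 𝒱 col(v, p⊗v, p⊗p⊗v) = (Ā(p) + B̄(p) K(p)) v, i.e., the data-based map represents the closed-loop LPV velocity dynamics under the feedback law Δu_k = K(p_k) Δx_k. -/
open Matrix Kronecker

/-- Kronecker product of two (finitely indexed) vectors: `(p ⊗ v)_{(i,j)} = p_i v_j`. -/
def vecKron {a b : Type*} (p : a → ℝ) (v : b → ℝ) : a × b → ℝ := fun q => p q.1 * v q.2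

/-- The horizontal concatenation `K̄ = [K₁ ⋯ K_{n_p}]` of the gain matrices. -/
def KbarOf {nx nu np : ℕ} (K : Fin np → Matrix (Fin nu) (Fin nx) ℝ) :
    Matrix (Fin nu) (Fin np × Fin nx) ℝ :=
  Matrix.of fun i q => K q.1 i q.2

/-- The block matrix
`[[I,0,0],[0,I⊗I,0],[K₀,K̄,0],[0,I⊗K₀,I⊗K̄]]` appearing in the closed-loop
data-driven representation. -/
def bigBlock {nx nu np : ℕ} (K0 : Matrix (Fin nu) (Fin nx) ℝ)
    (Kbar : Matrix (Fin nu) (Fin np × Fin nx) ℝ) :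
    Matrix ((Fin nx ⊕ Fin np × Fin nx) ⊕ (Fin nu ⊕ Fin np × Fin nu))
      ((Fin nx ⊕ Fin np × Fin nx) ⊕ Fin np × (Fin np × Fin nx)) ℝ :=
  Matrix.fromBlocks 1 0
    (Matrix.fromBlocks K0 Kbar 0 ((1 : Matrix (Fin np) (Fin np) ℝ) ⊗ₖ K0))
    (Matrix.fromRows 0 ((1 : Matrix (Fin np) (Fin np) ℝ) ⊗ₖ Kbar))

theorem Matrix.exists_mul_eq_of_rank_eq_card {m n l : Type*} [Fintype m] [Fintype n]
    {G : Matrix m n ℝ} (hG : G.rank = Fintype.card m) (M : Matrix m l ℝ) :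
    ∃ V : Matrix n l ℝ, G * V = M := by
  classical
  have htop : LinearMap.range G.mulVecLin = ⊤ := by
    apply Submodule.eq_top_of_finrank_eq
    rw [Module.finrank_fintype_fun_eq_card]
    exact hG
  choose V hV using fun j => LinearMap.range_eq_top.mp htop (M.col j)
  refine ⟨Matrix.of fun i j => V j i, ?_⟩
  ext i j
  exact congrFun (hV j) i

theorem add_sum_smul_mulVec {a b c : ℕ} (M0 : Matrix (Fin a) (Fin b) ℝ)
    (M : Fin c → Matrix (Fin a) (Fin b) ℝ) (p : Fin c → ℝ) (v : Fin b → ℝ) :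
    (M0 + ∑ i, p i • M i) *ᵥ v = M0 *ᵥ v + KbarOf M *ᵥ vecKron p v := by
  rw [add_mulVec, sum_mulVec]
  congr 1
  ext i
  simp only [Finset.sum_apply, mulVec, dotProduct, KbarOf, vecKron, of_apply, Matrix.smul_apply,
    smul_eq_mul, Fintype.sum_prod_type]
  exact Finset.sum_congr rfl fun _ _ => Finset.sum_congr rfl fun _ _ => by ring

theorem one_kronecker_mulVec_vecKron {a b c : Type*} [Fintype a] [DecidableEq a] [Fintype c]
    (M : Matrix b c ℝ) (p : a → ℝ) (v : c → ℝ) :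
    ((1 : Matrix a a ℝ) ⊗ₖ M) *ᵥ vecKron p v = vecKron p (M *ᵥ v) := by
  ext ⟨i, j⟩
  simp only [mulVec, dotProduct, kroneckerMap_apply, vecKron, Fintype.sum_prod_type, one_apply]
  rw [Finset.sum_eq_single i (fun k _ hk => by simp [hk.symm]) (by simp), Finset.mul_sum]
  exact Finset.sum_congr rfl fun _ _ => by simp; ring

theorem vecKron_add {a b : Type*} (p : a → ℝ) (v w : b → ℝ) :
    vecKron p (v + w) = vecKron p v + vecKron p w := by
  ext q
  simp [vecKron, mul_add]

theorem bigBlock_mulVec {nx nu np : ℕ} (K0 : Matrix (Fin nu) (Fin nx) ℝ)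
    (K : Fin np → Matrix (Fin nu) (Fin nx) ℝ) (p : Fin np → ℝ) (v : Fin nx → ℝ) :
    bigBlock K0 (KbarOf K) *ᵥ
        Sum.elim (Sum.elim v (vecKron p v)) (vecKron p (vecKron p v)) =
      Sum.elim (Sum.elim v (vecKron p v))
        (Sum.elim ((K0 + ∑ i, p i • K i) *ᵥ v)
          (vecKron p ((K0 + ∑ i, p i • K i) *ᵥ v))) := by
  simp only [bigBlock, fromBlocks_mulVec, fromRows_mulVec, Sum.elim_comp_inl, Sum.elim_comp_inr,
    one_mulVec, zero_mulVec, add_zero, zero_add, one_kronecker_mulVec_vecKron,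
    add_sum_smul_mulVec, vecKron_add]
  congr 1
  ext (i | i) <;> simp

/-- Data-based closed-loop velocity representation.  Given data
`{Δx_k, p_k, Δu_k}` satisfying the affine LPV velocity dynamics, with data matrices
`X_Δ, X^p_Δ, U_Δ, U^p_Δ, X→_Δ` and `𝒢_Δ = col(X_Δ, X^p_Δ, U_Δ, U^p_Δ)`:
(i) if `𝒢_Δ` has full row rank `(1+n_p)(n_x+n_u)`, then for any controller gains
there exists `𝒱` with `𝒢_Δ 𝒱` equal to the controller block matrix; and (ii) any
such `𝒱` yields `X→_Δ 𝒱 col(v, p⊗v, p⊗p⊗v) = (Ā(p)+B̄(p)K(p))v` for all `p, v`. -/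
theorem stmt_4 {nx nu np N : ℕ}
    (A0 : Matrix (Fin nx) (Fin nx) ℝ) (A : Fin np → Matrix (Fin nx) (Fin nx) ℝ)
    (B0 : Matrix (Fin nx) (Fin nu) ℝ) (B : Fin np → Matrix (Fin nx) (Fin nu) ℝ)
    (Δx : ℕ → Fin nx → ℝ) (Δu : ℕ → Fin nu → ℝ) (pd : ℕ → Fin np → ℝ)
    (hdata : ∀ j : Fin (N - 1), Δx ((j : ℕ) + 3) =
      (Abar A0 A (pd ((j : ℕ) + 2))).mulVec (Δx ((j : ℕ) + 2)) +
      (Bbar B0 B (pd ((j : ℕ) + 2))).mulVec (Δu ((j : ℕ) + 2)))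
    (XΔ : Matrix (Fin nx) (Fin (N - 1)) ℝ)
    (hX : XΔ = Matrix.of fun i (j : Fin (N - 1)) => Δx ((j : ℕ) + 2) i)
    (XpΔ : Matrix (Fin np × Fin nx) (Fin (N - 1)) ℝ)
    (hXp : XpΔ = Matrix.of fun q (j : Fin (N - 1)) => vecKron (pd ((j : ℕ) + 2)) (Δx ((j : ℕ) + 2)) q)
    (UΔ : Matrix (Fin nu) (Fin (N - 1)) ℝ)
    (hU : UΔ = Matrix.of fun i (j : Fin (N - 1)) => Δu ((j : ℕ) + 2) i)
    (UpΔ : Matrix (Fin np × Fin nu) (Fin (N - 1)) ℝ)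
    (hUp : UpΔ = Matrix.of fun q (j : Fin (N - 1)) => vecKron (pd ((j : ℕ) + 2)) (Δu ((j : ℕ) + 2)) q)
    (Xfwd : Matrix (Fin nx) (Fin (N - 1)) ℝ)
    (hXf : Xfwd = Matrix.of fun i (j : Fin (N - 1)) => Δx ((j : ℕ) + 3) i)
    (GΔ : Matrix ((Fin nx ⊕ Fin np × Fin nx) ⊕ (Fin nu ⊕ Fin np × Fin nu)) (Fin (N - 1)) ℝ)
    (hG : GΔ = Matrix.fromRows (Matrix.fromRows XΔ XpΔ) (Matrix.fromRows UΔ UpΔ)) :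
    (GΔ.rank = (1 + np) * (nx + nu) →
      ∀ (K0 : Matrix (Fin nu) (Fin nx) ℝ) (K : Fin np → Matrix (Fin nu) (Fin nx) ℝ),
        ∃ V : Matrix (Fin (N - 1)) ((Fin nx ⊕ Fin np × Fin nx) ⊕ Fin np × (Fin np × Fin nx)) ℝ,
          GΔ * V = bigBlock K0 (KbarOf K)) ∧
    (∀ (K0 : Matrix (Fin nu) (Fin nx) ℝ) (K : Fin np → Matrix (Fin nu) (Fin nx) ℝ)
        (V : Matrix (Fin (N - 1)) ((Fin nx ⊕ Fin np × Fin nx) ⊕ Fin np × (Fin np × Fin nx)) ℝ),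
        GΔ * V = bigBlock K0 (KbarOf K) →
        ∀ (p : Fin np → ℝ) (v : Fin nx → ℝ),
          (Xfwd * V).mulVec (Sum.elim (Sum.elim v (vecKron p v)) (vecKron p (vecKron p v))) =
            (Abar A0 A p + Bbar B0 B p * (K0 + ∑ i, p i • K i)).mulVec v) := by
  constructor
  · intro hrank K0 K
    refine Matrix.exists_mul_eq_of_rank_eq_card (hrank.trans ?_) _
    simp only [Fintype.card_sum, Fintype.card_prod, Fintype.card_fin]
    ring
  · intro K0 K V hV p v
    have hXG : Xfwd = fromCols (fromCols A0 (KbarOf A)) (fromCols B0 (KbarOf B)) * GΔ := by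
      subst hX hXp hU hUp hXf hG
      rw [fromCols_mul_fromRows, fromCols_mul_fromRows, fromCols_mul_fromRows]
      ext i j
      rw [of_apply, hdata j, Abar, Bbar, add_sum_smul_mulVec, add_sum_smul_mulVec]
      rfl
    rw [hXG, Matrix.mul_assoc, hV, ← mulVec_mulVec, bigBlock_mulVec, add_mulVec (Abar A0 A p),
      ← mulVec_mulVec, Abar, Bbar, add_sum_smul_mulVec A0, add_sum_smul_mulVec B0]
    simp only [fromCols_mulVec, Sum.elim_comp_inl, Sum.elim_comp_inr]
end

section
/- (Controller recovery from the synthesis variables.) Let 𝒢_Δ ∈ ℝ^{(1+n_p)(n_x+n_u) × (N−1)}, ℱ ∈ ℝ^{(N−1) × n_x(1+n_p+n_p²)}, Z ∈ ℝ^{n_x×n_x} invertible, Y₀ ∈ ℝ^{n_u×n_x}, Ȳ ∈ ℝ^{n_u×n_x n_p}, and suppose 𝒢_Δ ℱ = [[Z,0,0],[0, I_{n_p}⊗Z, 0],[Y₀, Ȳ, 0],[0, I_{n_p}⊗Y₀, I_{n_p}⊗Ȳ]]. Define K₀ = Y₀ Z^{-1}, K̄ = Ȳ (I_{n_p}⊗Z)^{-1},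 and 𝒱 = ℱ · blkdiag(Z^{-1}, (I_{n_p}⊗Z)^{-1}, (I_{n_p²}⊗Z)^{-1}). Then 𝒱 satisfies the closed-loop consistency condition 𝒢_Δ 𝒱 = [[I_{n_x},0,0],[0, I_{n_p}⊗I_{n_x}, 0],[K₀, K̄, 0],[0, I_{n_p}⊗K₀, I_{n_p}⊗K̄]]. -/
open Matrix Kronecker

/-- Controller recovery from the synthesis variables: if
`𝒢_Δ ℱ = [[Z,0,0],[0,I⊗Z,0],[Y₀,Ȳ,0],[0,I⊗Y₀,I⊗Ȳ]]` with `Z` invertible, then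
`𝒱 = ℱ · blkdiag(Z⁻¹, (I⊗Z)⁻¹, (I⊗I⊗Z)⁻¹)` satisfies the closed-loop consistency
condition with `K₀ = Y₀Z⁻¹` and `K̄ = Ȳ(I⊗Z)⁻¹`. -/
theorem stmt_5 {nx nu np N : ℕ}
    (GΔ : Matrix ((Fin nx ⊕ Fin np × Fin nx) ⊕ (Fin nu ⊕ Fin np × Fin nu)) (Fin (N - 1)) ℝ)
    (F : Matrix (Fin (N - 1)) ((Fin nx ⊕ Fin np × Fin nx) ⊕ Fin np × (Fin np × Fin nx)) ℝ)
    (Z : Matrix (Fin nx) (Fin nx) ℝ) (hZ : IsUnit Z.det)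
    (Y0 : Matrix (Fin nu) (Fin nx) ℝ) (Ybar : Matrix (Fin nu) (Fin np × Fin nx) ℝ)
    (hGF : GΔ * F = Matrix.fromBlocks
      (Matrix.fromBlocks Z 0 0 ((1 : Matrix (Fin np) (Fin np) ℝ) ⊗ₖ Z)) 0
      (Matrix.fromBlocks Y0 Ybar 0 ((1 : Matrix (Fin np) (Fin np) ℝ) ⊗ₖ Y0))
      (Matrix.fromRows 0 ((1 : Matrix (Fin np) (Fin np) ℝ) ⊗ₖ Ybar))) :
    GΔ * (F * Matrix.fromBlocks
        (Matrix.fromBlocks Z⁻¹ 0 0 ((1 : Matrix (Fin np) (Fin np) ℝ) ⊗ₖ Z)⁻¹) 0 0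
        ((1 : Matrix (Fin np) (Fin np) ℝ) ⊗ₖ ((1 : Matrix (Fin np) (Fin np) ℝ) ⊗ₖ Z))⁻¹) =
      bigBlock (Y0 * Z⁻¹) (Ybar * ((1 : Matrix (Fin np) (Fin np) ℝ) ⊗ₖ Z)⁻¹) := by
  have hK {l : Type} (A : Matrix l (Fin nx) ℝ) :
      ((1 : Matrix (Fin np) (Fin np) ℝ) ⊗ₖ A) * ((1 : Matrix (Fin np) (Fin np) ℝ) ⊗ₖ Z)⁻¹ =
        (1 : Matrix (Fin np) (Fin np) ℝ) ⊗ₖ (A * Z⁻¹) := by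
    rw [inv_kronecker, inv_one, ← mul_kronecker_mul, one_mul]
  have hKbar :
      ((1 : Matrix (Fin np) (Fin np) ℝ) ⊗ₖ Ybar) *
          ((1 : Matrix (Fin np) (Fin np) ℝ) ⊗ₖ ((1 : Matrix (Fin np) (Fin np) ℝ) ⊗ₖ Z))⁻¹ =
        (1 : Matrix (Fin np) (Fin np) ℝ) ⊗ₖ
          (Ybar * ((1 : Matrix (Fin np) (Fin np) ℝ) ⊗ₖ Z)⁻¹) := by
    rw [inv_kronecker 1 ((1 : Matrix (Fin np) (Fin np) ℝ) ⊗ₖ Z), inv_one,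
      ← mul_kronecker_mul, one_mul]
  rw [← Matrix.mul_assoc, hGF, bigBlock]
  simp only [fromBlocks_multiply, fromRows_mul, Matrix.mul_zero, Matrix.zero_mul, add_zero,
    zero_add, hK, hKbar, mul_nonsing_inv Z hZ, one_kronecker_one, fromBlocks_one]
end
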